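/- For every real L there exists K such that every finite poset P with π(P) ≥ K satisfies σ(P) ≥ L. (In the paper's notation: π ⇝ σ, i.e. σ(P) tends to infinity as π(P) does.) -/

import Mathlib

open Finset

section Defs
variable (α : Type*) [Fintype α] [PartialOrder α]

/-- Linear extensions of a finite poset `α` with `n` elements: order-preserving
bijections to `Fin n` (representing the target `{1,…,n}`). -/
def LinExt : Type _ :=
  {f : α ≃ Fin (Fintype.card α) // ∀ x y : α, x < y → f x < f y}

instance : Finite (LinExt α) := by unfold LinExt; infer_instance

noncomputable instance : Fintype (LinExt α) := Fintype.ofFinite _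

end Defs

section Defs2
variable {α : Type*} [Fintype α] [PartialOrder α]

/-- the uniform probability `ℙ(E)` of an event `E` on linear extensions -/
noncomputable def Pr (E : LinExt α → Prop) : ℝ :=
  (Nat.card {f : LinExt α // E f} : ℝ) / (Nat.card (LinExt α) : ℝ)

/-- the value `f(x) ∈ {1,…,n}` of a linear extension at `x` -/
def val (f : LinExt α) (x : α) : ℕ := (f.1 x : ℕ) + 1

/-- `ℙ(x ≺ y)`, the probability that `x` precedes `y` in a uniform linear extension -/
noncomputable def prLT (x y : α) : ℝ := Pr (fun f => val f x < val f y)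

/-- the expectation `𝔼 f(x)` for `f` uniform on `E(P)` -/
noncomputable def expec (x : α) : ℝ :=
  (∑ f : LinExt α, (val f x : ℝ)) / (Nat.card (LinExt α) : ℝ)

/-- the variance `Var(f(x))` for `f` uniform on `E(P)` -/
noncomputable def variance (x : α) : ℝ :=
  (∑ f : LinExt α, ((val f x : ℝ) - expec x) ^ 2) / (Nat.card (LinExt α) : ℝ)

/-- the standard deviation `σ(x)` of `f(x)` -/
noncomputable def sigma (x : α) : ℝ := Real.sqrt (variance x)

/-- `π(x)`: the number of elements of the poset incomparable to `x` -/
noncomputable def piVal (x : α) : ℕ := Nat.card {y : α // ¬ x ≤ y ∧ ¬ y ≤ x}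

/-- `q(x) = max_{k ∈ {1,…,n}} ℙ(f(x) = k)` -/
noncomputable def qVal (x : α) : ℝ :=
  ⨆ k : Fin (Fintype.card α), Pr (fun f => val f x = (k : ℕ) + 1)

end Defs2

/-- Anticoncentration of the middle binomial coefficient. -/
lemma four_mul_mul_centralBinom_le (s k : ℕ) (hk : 16 * s ^ 2 ≤ 2 * k + 1) :
    4 * s * k.centralBinom ≤ 4 ^ k := by
  have key : ∀ k : ℕ, (2 * k + 1) * k.centralBinom ^ 2 ≤ 16 ^ k := by
    intro k
    induction k with
    | zero => simp
    | succ k ih =>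
      have h := Nat.succ_mul_centralBinom_succ k
      have h2 : (k + 1) ^ 2 * (k + 1).centralBinom ^ 2
          = 4 * (2 * k + 1) ^ 2 * k.centralBinom ^ 2 := by
        rw [← mul_pow, h]; ring
      have h3 : (k + 1) ^ 2 * ((2 * (k + 1) + 1) * (k + 1).centralBinom ^ 2)
          ≤ (k + 1) ^ 2 * 16 ^ (k + 1) := by
        calc (k + 1) ^ 2 * ((2 * (k + 1) + 1) * (k + 1).centralBinom ^ 2)
            = (2 * k + 3) * ((k + 1) ^ 2 * (k + 1).centralBinom ^ 2) := by ring
          _ = 4 * ((2 * k + 3) * (2 * k + 1)) * ((2 * k + 1) * k.centralBinom ^ 2) := by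
              rw [h2]; ring
          _ ≤ 4 * (4 * (k + 1) ^ 2) * 16 ^ k := by
              have : (2 * k + 3) * (2 * k + 1) ≤ 4 * (k + 1) ^ 2 := by nlinarith
              exact Nat.mul_le_mul (Nat.mul_le_mul_left 4 this) ih
          _ = (k + 1) ^ 2 * 16 ^ (k + 1) := by ring
      exact Nat.le_of_mul_le_mul_left h3 (by positivity)
  have h1 : (4 * s * k.centralBinom) ^ 2 ≤ (4 ^ k) ^ 2 := by
    calc (4 * s * k.centralBinom) ^ 2 = 16 * s ^ 2 * k.centralBinom ^ 2 := by ring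
      _ ≤ (2 * k + 1) * k.centralBinom ^ 2 := by gcongr
      _ ≤ 16 ^ k := key k
      _ = (4 ^ k) ^ 2 := by rw [← pow_mul, mul_comm, pow_mul]; norm_num
  exact (Nat.pow_le_pow_iff_left two_ne_zero).1 h1

lemma four_mul_mul_choose_half_le (s m : ℕ) (hm : 16 * s ^ 2 + 2 ≤ m) :
    4 * s * m.choose (m / 2) ≤ 2 ^ m := by
  obtain ⟨k, rfl | rfl⟩ := m.even_or_odd'
  · have := four_mul_mul_centralBinom_le s k (by omega)
    rw [Nat.centralBinom] at this
    rw [Nat.mul_div_cancel_left _ two_pos, pow_mul]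
    exact this
  · have := four_mul_mul_centralBinom_le s k (by omega)
    have hk : (2 * k + 1) / 2 = k := by omega
    rw [hk, pow_succ, pow_mul]
    obtain _ | j := k
    · simp at hm
    · have h2 : (2 * (j + 1) + 1).choose (j + 1) ≤ 2 * (j + 1).centralBinom := by
        rw [Nat.choose_succ_succ, two_mul (Nat.centralBinom _)]
        exact add_le_add (Nat.choose_le_centralBinom _ _) (Nat.choose_le_centralBinom _ _)
      norm_num at *
      nlinarith

/-- At least one eighth of the subsets of a large set `M` have size at most `#M / 2 - s`. -/
lemma two_pow_le_eight_mul_card_small_subsets {ι : Type*} [DecidableEq ι] (M : Finset ι) (s : ℕ)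
    (hM : 16 * s ^ 2 + 2 ≤ #M) :
    2 ^ #M ≤ 8 * #{Y ∈ M.powerset | 2 * #Y + 2 * s ≤ #M} := by
  set lo := M.powerset.filter (fun Y => 2 * #Y + 2 * s ≤ #M) with hlo
  set hi := M.powerset.filter (fun Y => #M + 2 * s ≤ 2 * #Y) with hhi
  set mid := M.powerset.filter (fun Y => #M < 2 * #Y + 2 * s ∧ 2 * #Y < #M + 2 * s) with hmid
  have hcover : M.powerset ⊆ lo ∪ hi ∪ mid := by
    intro Y hY
    simp only [hlo, hhi, hmid, mem_union, mem_filter, hY, true_and]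
    omega
  have hhl : #hi ≤ #lo := by
    refine card_le_card_of_injOn (fun Y => M \ Y) ?_ ?_
    · intro Y hY
      simp only [hhi, coe_filter, mem_powerset, Set.mem_ofPred_eq] at hY
      simp only [hlo, coe_filter, mem_powerset, Set.mem_ofPred_eq]
      have := card_sdiff_add_card_eq_card hY.1
      exact ⟨sdiff_subset, by omega⟩
    · intro Y hY Z hZ h
      simp only [hhi, coe_filter, mem_powerset, Set.mem_ofPred_eq] at hY hZ
      have h : M \ Y = M \ Z := h
      rw [← Finset.sdiff_sdiff_eq_self hY.1, h, Finset.sdiff_sdiff_eq_self hZ.1]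
  have hmc : #mid ≤ 2 * s * (#M).choose (#M / 2) := by
    have hsub : mid ⊆ (Ioo (#M / 2 - s) (#M / 2 + s + 1)).biUnion (fun j => M.powersetCard j) := by
      intro Y hY
      simp only [hmid, mem_filter, mem_powerset] at hY
      simp only [mem_biUnion, mem_Ioo, mem_powersetCard]
      refine ⟨#Y, ?_, hY.1, rfl⟩
      have : s ≤ #M / 2 := by
        have : s ≤ s ^ 2 := Nat.le_self_pow two_ne_zero s
        omega
      omega
    calc #mid ≤ _ := card_le_card hsub
      _ ≤ ∑ j ∈ Ioo (#M / 2 - s) (#M / 2 + s + 1), #(M.powersetCard j) := card_biUnion_le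
      _ ≤ ∑ j ∈ Ioo (#M / 2 - s) (#M / 2 + s + 1), (#M).choose (#M / 2) := by
          refine sum_le_sum fun j _ => ?_
          rw [card_powersetCard]
          exact Nat.choose_le_middle _ _
      _ ≤ 2 * s * (#M).choose (#M / 2) := by
          rw [sum_const, smul_eq_mul, Nat.card_Ioo]
          gcongr
          omega
  have h1 := card_le_card hcover
  rw [card_powerset] at h1
  have h2 := card_union_le (lo ∪ hi) mid
  have h3 := card_union_le lo hi
  have h4 := four_mul_mul_choose_half_le s #M hM
  have h5 : 2 * (2 * s * (#M).choose (#M / 2)) = 4 * s * (#M).choose (#M / 2) := by ring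
  omega

/-- A fibrewise application of the Harris-Kleitman inequality: on each fibre of `key`, the sets
`Y ω` form a lower set of subsets of `M`. -/
lemma card_large_le_eight_mul_card_unbalanced {Ω κ ι : Type*} [Fintype Ω] [DecidableEq κ]
    [DecidableEq ι] (key : Ω → κ) (Y : Ω → Finset ι) (M : κ → Finset ι)
    (hYM : ∀ ω, Y ω ⊆ M (key ω))
    (hinj : ∀ ω ω', key ω = key ω' → Y ω = Y ω' → ω = ω')
    (hdown : ∀ ω, ∀ i ∈ Y ω, ∃ ω', key ω' = key ω ∧ Y ω' = (Y ω).erase i) (s : ℕ) :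
    #{ω : Ω | 16 * s ^ 2 + 2 ≤ #(M (key ω))}
      ≤ 8 * #{ω : Ω | 2 * #(Y ω) + 2 * s ≤ #(M (key ω))} := by
  have hfib : ∀ (p : Ω → Prop) [DecidablePred p], #{ω : Ω | p ω}
      = ∑ k ∈ univ.image key, #{ω : Ω | p ω ∧ key ω = k} := by
    intro p _
    rw [card_eq_sum_card_fiberwise (f := key) (t := univ.image key)]
    · simp only [filter_filter]
    · intro ω _
      simp
  rw [hfib, hfib, mul_sum]
  refine sum_le_sum fun k _ => ?_
  by_cases hk : 16 * s ^ 2 + 2 ≤ #(M k)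
  · set 𝒜 : Finset (Finset ι) := ({ω : Ω | key ω = k} : Finset Ω).image Y with h𝒜
    set ℬ : Finset (Finset ι) := {Z ∈ (M k).powerset | 2 * #Z + 2 * s ≤ #(M k)} with hℬ
    have hinjOn : Set.InjOn Y {ω | key ω = k} := by
      intro ω hω ω' hω' h
      exact hinj ω ω' (Eq.trans hω (Eq.symm hω')) h
    have hlower : IsLowerSet (𝒜 : Set (Finset ι)) := by
      have hsd : ∀ (W : Finset ι) (Z : Finset ι), Z ∈ 𝒜 → Z \ W ∈ 𝒜 := by
        intro W
        induction W using Finset.induction with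
        | empty => intro Z hZ; simpa using hZ
        | insert a W ha ih =>
          intro Z hZ
          by_cases haZ : a ∈ Z
          · have : Z \ insert a W = Z.erase a \ W := by
              ext x; simp; tauto
            rw [this]
            apply ih
            simp only [h𝒜, mem_image, mem_filter, mem_univ, true_and] at hZ ⊢
            obtain ⟨ω, hω, rfl⟩ := hZ
            obtain ⟨ω', h1, h2⟩ := hdown ω a haZ
            exact ⟨ω', h1.trans hω, h2⟩
          · have : Z \ insert a W = Z \ W := by
              ext x; simp only [mem_sdiff, mem_insert, not_or]
              constructor
              · tauto
              · rintro ⟨h1, h2⟩; exact ⟨h1, fun h => haZ (h ▸ h1), h2⟩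
            rw [this]
            exact ih _ hZ
      intro Z Z' hZZ' hZ
      have : Z' = Z \ (Z \ Z') := (Finset.sdiff_sdiff_eq_self hZZ').symm
      rw [this]
      exact hsd _ _ hZ
    have hlowerB : IsLowerSet (ℬ : Set (Finset ι)) := by
      intro Z Z' hZZ' hZ
      simp only [hℬ, coe_filter, mem_powerset, Set.mem_ofPred_eq] at hZ ⊢
      have := card_le_card hZZ'
      exact ⟨hZZ'.trans hZ.1, by omega⟩
    have hHK := hlower.le_card_inter_finset' hlowerB (s := M k)
      (by
        intro t ht
        simp only [h𝒜, mem_image, mem_filter, mem_univ, true_and] at ht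
        obtain ⟨ω, rfl, rfl⟩ := ht
        exact hYM ω)
      (by
        intro t ht
        simp only [hℬ, mem_filter, mem_powerset] at ht
        exact ht.1)
    have hbin := two_pow_le_eight_mul_card_small_subsets (M k) s hk
    have hA : #{ω : Ω | 16 * s ^ 2 + 2 ≤ #(M (key ω)) ∧ key ω = k} ≤ #𝒜 := by
      rw [h𝒜, card_image_of_injOn (by simpa using hinjOn)]
      exact card_le_card (fun ω => by simp)
    have hAB : #(𝒜 ∩ ℬ) ≤ #{ω : Ω | 2 * #(Y ω) + 2 * s ≤ #(M (key ω)) ∧ key ω = k} := by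
      refine (card_le_card ?_).trans (card_image_le (f := Y))
      intro Z hZ
      simp only [h𝒜, hℬ, mem_inter, mem_image, mem_filter, mem_univ, true_and] at hZ
      obtain ⟨⟨ω, hω, rfl⟩, h2⟩ := hZ
      simp only [mem_image, mem_filter, mem_univ, true_and]
      exact ⟨ω, ⟨by rw [hω]; exact h2.2, hω⟩, rfl⟩
    have hpos : 0 < 2 ^ #(M k) := by positivity
    have h1 : 2 ^ #(M k) * #𝒜 ≤ 2 ^ #(M k) * (8 * #(𝒜 ∩ ℬ)) := by
      calc 2 ^ #(M k) * #𝒜 ≤ 8 * #ℬ * #𝒜 := by gcongr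
        _ = 8 * (#𝒜 * #ℬ) := by ring
        _ ≤ 8 * (2 ^ #(M k) * #(𝒜 ∩ ℬ)) := by gcongr
        _ = _ := by ring
    have h2 := Nat.le_of_mul_le_mul_left h1 hpos
    omega
  · rw [card_eq_zero.2]
    · exact Nat.zero_le _
    · ext ω
      simp only [mem_filter, mem_univ, true_and, notMem_empty, iff_false, not_and]
      rintro h rfl
      exact hk h

section LinearExtensions
variable {α : Type*} [Fintype α] [PartialOrder α]

/-- The zero-based position of `a` in the linear extension `f`. -/
def pos (f : LinExt α) (a : α) : ℕ := (f.1 a : ℕ)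

lemma val_eq_pos_add_one (f : LinExt α) (a : α) : val f a = pos f a + 1 := rfl

lemma pos_injective (f : LinExt α) : Function.Injective (pos f) :=
  fun _ _ h => f.1.injective (Fin.ext h)

lemma pos_lt (f : LinExt α) (a : α) : pos f a < Fintype.card α := (f.1 a).2

lemma pos_lt_pos (f : LinExt α) {a b : α} (h : a < b) : pos f a < pos f b := f.2 a b h

lemma exists_pos_eq (f : LinExt α) {t : ℕ} (ht : t < Fintype.card α) : ∃ a, pos f a = t :=
  ⟨f.1.symm ⟨t, ht⟩, by simp [pos]⟩

lemma linExt_ext {f g : LinExt α} (h : ∀ a, pos f a = pos g a) : f = g :=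
  Subtype.ext (Equiv.ext fun a => Fin.ext (h a))

/-- Exchanging two elements in consecutive positions, when the order allows it. -/
lemma exists_adjacent_swap (f : LinExt α) {a b : α} (hab : pos f b = pos f a + 1)
    (hlt : ¬ a < b) :
    ∃ g : LinExt α, pos g a = pos f b ∧ pos g b = pos f a ∧
      ∀ z, z ≠ a → z ≠ b → pos g z = pos f z := by
  classical
  have hne : a ≠ b := by rintro rfl; omega
  have key : ∀ z, pos f (Equiv.swap a b z)
      = if z = a then pos f b else if z = b then pos f a else pos f z := by
    intro z
    rw [Equiv.swap_apply_def]
    split_ifs <;> rfl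
  refine ⟨⟨(Equiv.swap a b).trans f.1, ?_⟩, ?_, ?_, ?_⟩
  · intro x y hxy
    have h1 := pos_lt_pos f hxy
    change pos f (Equiv.swap a b x) < pos f (Equiv.swap a b y)
    rw [key, key]
    have hinj : ∀ u v : α, u ≠ v → pos f u ≠ pos f v := fun u v h h' => h (pos_injective f h')
    split_ifs with h2 h3 h4 h5 h6 h7 <;> subst_vars
    · exact absurd hxy (lt_irrefl _)
    · exact absurd hxy hlt
    · have := hinj _ _ h4; omega
    · omega
    · exact absurd hxy (lt_irrefl _)
    · have := hinj _ _ h6; omega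
    · omega
    · have := hinj _ _ h2; omega
    · omega
  · change pos f (Equiv.swap a b a) = _
    simp
  · change pos f (Equiv.swap a b b) = _
    simp
  · intro z hza hzb
    change pos f (Equiv.swap a b z) = _
    rw [Equiv.swap_apply_of_ne_of_ne hza hzb]

/-- The set of positions occupied by `A` in the linear extension `f`. -/
def positions (A : Finset α) (f : LinExt α) : Finset ℕ := A.image (pos f)

lemma pos_mem_positions {A : Finset α} {f : LinExt α} {a : α} :
    pos f a ∈ positions A f ↔ a ∈ A := by
  simp only [positions, mem_image]
  exact ⟨fun ⟨b, hb, h⟩ => pos_injective f h ▸ hb, fun h => ⟨a, h, rfl⟩⟩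

lemma lt_card_of_mem_positions {A : Finset α} {f : LinExt α} {t : ℕ} (h : t ∈ positions A f) :
    t < Fintype.card α := by
  obtain ⟨a, -, rfl⟩ := mem_image.1 h
  exact pos_lt f a

/-- Two linear extensions restrict to the same order on `A` and on its complement. -/
def SameOrders (A : Finset α) (f g : LinExt α) : Prop :=
  ∀ a b, (a ∈ A ↔ b ∈ A) → (pos f a < pos f b ↔ pos g a < pos g b)

lemma SameOrders.trans {A : Finset α} {f g h : LinExt α} (h1 : SameOrders A f g)
    (h2 : SameOrders A g h) : SameOrders A f h :=
  fun a b hab => (h1 a b hab).trans (h2 a b hab)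

lemma SameOrders.eq_of_positions_eq {A : Finset α} {f g : LinExt α} (h : SameOrders A f g)
    (hS : positions A f = positions A g) : f = g := by
  classical
  have count : ∀ (f : LinExt α) (S : Finset ℕ) (a : α), positions A f = S →
      #{t ∈ range (pos f a) | t ∈ S ↔ a ∈ A}
        = #{b : α | (b ∈ A ↔ a ∈ A) ∧ pos f b < pos f a} := by
    rintro f S a rfl
    symm
    refine card_bij (fun b _ => pos f b) ?_ ?_ ?_
    · intro b hb
      simp only [mem_filter, mem_univ, true_and] at hb
      simp only [mem_filter, mem_range, pos_mem_positions]
      exact ⟨hb.2, hb.1⟩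
    · intro b _ c _ hbc
      exact pos_injective f hbc
    · intro t ht
      simp only [mem_filter, mem_range] at ht
      obtain ⟨b, rfl⟩ := exists_pos_eq f (ht.1.trans (pos_lt f a))
      rw [pos_mem_positions] at ht
      exact ⟨b, by simp [ht.1, ht.2], rfl⟩
  refine linExt_ext fun a => ?_
  have h1 : #{t ∈ range (pos f a) | t ∈ positions A f ↔ a ∈ A}
      = #{t ∈ range (pos g a) | t ∈ positions A f ↔ a ∈ A} := by
    rw [count f _ a rfl, count g _ a hS.symm]
    congr 1
    ext b
    simp only [mem_filter, mem_univ, true_and]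
    exact and_congr_right fun hb => h b a hb
  have strict : ∀ m n : ℕ, m < n → (m ∈ positions A f ↔ a ∈ A) →
      #{t ∈ range m | t ∈ positions A f ↔ a ∈ A}
        < #{t ∈ range n | t ∈ positions A f ↔ a ∈ A} := by
    intro m n hmn hm
    apply card_lt_card
    rw [ssubset_iff_of_subset (filter_subset_filter _ (range_subset_range.2 hmn.le))]
    exact ⟨m, by simp [hmn, hm], by simp⟩
  rcases lt_trichotomy (pos f a) (pos g a) with hlt | heq | hgt
  · exact absurd h1 (strict _ _ hlt pos_mem_positions).ne
  · exact heq
  · refine absurd h1 (strict _ _ hgt ?_).ne'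
    rw [hS]
    exact pos_mem_positions

lemma exists_advance_adjacent {A : Finset α} (hA : IsLowerSet (A : Set α)) (f : LinExt α) {t : ℕ}
    (h0 : t ∉ positions A f) (h1 : t + 1 ∈ positions A f) :
    ∃ g : LinExt α, SameOrders A f g ∧
      positions A g = insert t ((positions A f).erase (t + 1)) := by
  have hlt := lt_card_of_mem_positions h1
  obtain ⟨a, rfl⟩ := exists_pos_eq f (t := t) (by omega)
  obtain ⟨b, hb, hba⟩ := mem_image.1 h1
  rw [pos_mem_positions] at h0
  obtain ⟨g, hga, hgb, hg⟩ := exists_adjacent_swap f hba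
    (fun h => h0 (mem_coe.1 (hA h.le (mem_coe.2 hb))))
  have hinj : ∀ u v : α, u ≠ v → pos f u ≠ pos f v := fun u v h h' => h (pos_injective f h')
  refine ⟨g, ?_, ?_⟩
  · intro x y hxy
    by_cases hxa : x = a
    · subst hxa
      by_cases hya : y = x
      · subst hya; simp
      have hyb : y ≠ b := by rintro rfl; tauto
      rw [hga, hg y hya hyb]
      have := hinj _ _ hyb
      have := hinj _ _ hya
      omega
    by_cases hxb : x = b
    · subst hxb
      by_cases hyb : y = x
      · subst hyb; simp
      have hya : y ≠ a := by rintro rfl; tauto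
      rw [hgb, hg y hya hyb]
      have := hinj _ _ hyb
      have := hinj _ _ hya
      omega
    rw [hg x hxa hxb]
    have := hinj _ _ hxb
    have := hinj _ _ hxa
    by_cases hya : y = a
    · subst hya; rw [hga]; omega
    by_cases hyb : y = b
    · subst hyb; rw [hgb]; omega
    rw [hg y hya hyb]
  · ext u
    simp only [positions, mem_image, mem_insert, mem_erase]
    constructor
    · rintro ⟨x, hx, rfl⟩
      by_cases hxb : x = b
      · subst hxb; exact Or.inl hgb
      have hxa : x ≠ a := by rintro rfl; exact h0 hx
      rw [hg x hxa hxb]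
      exact Or.inr ⟨hba ▸ hinj _ _ hxb, x, hx, rfl⟩
    · rintro (rfl | ⟨hu, x, hx, rfl⟩)
      · exact ⟨b, hb, hgb⟩
      · have hxa : x ≠ a := by rintro rfl; exact h0 hx
        have hxb : x ≠ b := by rintro rfl; exact hu hba
        exact ⟨x, hx, hg x hxa hxb⟩

/-- Exchanging a letter of the complement of a lower set `A` with a later letter of `A`, keeping
the orders of `A` and of its complement, again gives a linear extension. -/
lemma exists_advance {A : Finset α} (hA : IsLowerSet (A : Set α)) (d : ℕ) :
    ∀ (f : LinExt α) (p : ℕ), p ∉ positions A f → p + d + 1 ∈ positions A f →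
    ∃ g : LinExt α, SameOrders A f g ∧
      positions A g = insert p ((positions A f).erase (p + d + 1)) := by
  induction d with
  | zero => exact fun f p h0 h1 => exists_advance_adjacent hA f h0 h1
  | succ d ih =>
    intro f p h0 h1
    by_cases hm : p + d + 1 ∈ positions A f
    · obtain ⟨g, hg1, hg2⟩ := ih f p h0 hm
      obtain ⟨g', hg1', hg2'⟩ := exists_advance_adjacent hA g (t := p + d + 1)
        (by rw [hg2]; simp; omega)
        (by rw [hg2]; simp only [mem_insert, mem_erase]; right; exact ⟨by omega, h1⟩)
      refine ⟨g', hg1.trans hg1', ?_⟩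
      rw [hg2', hg2]
      ext u
      simp only [mem_insert, mem_erase, ← add_assoc]
      by_cases hu : u = p + d + 1
      · subst hu
        simp [hm]
      · by_cases hu2 : u = p
        · subst hu2; simp; omega
        · simp [hu, hu2]
    · obtain ⟨g, hg1, hg2⟩ := exists_advance_adjacent hA f (t := p + d + 1) hm h1
      obtain ⟨g', hg1', hg2'⟩ := ih g p
        (by rw [hg2]; simp only [mem_insert, mem_erase, not_or, not_and]
            exact ⟨by omega, fun _ => h0⟩)
        (by rw [hg2]; simp)
      refine ⟨g', hg1.trans hg1', ?_⟩
      rw [hg2', hg2]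
      ext u
      simp only [mem_insert, mem_erase, ← add_assoc]
      by_cases hu : u = p + d + 1
      · subst hu
        simp [hm]
      · simp [hu]

lemma card_discordant_le_eight_mul {ι : Type*} [Fintype ι] {A : Finset α}
    (hA : IsLowerSet (A : Set α)) {p q : ι → ℕ} (hp : Function.Injective p)
    (hq : Function.Injective q) (hpq : ∀ i j, p i < q j) (s : ℕ) :
    #{f : LinExt α | 16 * s ^ 2 + 2 ≤ #{i | ¬ (p i ∈ positions A f ↔ q i ∈ positions A f)}}
      ≤ 8 * #{f : LinExt α | #{i | q i ∈ positions A f} + 2 * s ≤ #{i | p i ∈ positions A f}} := by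
  classical
  set M : LinExt α → Finset ι :=
    fun f => {i | ¬ (p i ∈ positions A f ↔ q i ∈ positions A f)} with hM
  set Y : LinExt α → Finset ι :=
    fun f => {i | p i ∉ positions A f ∧ q i ∈ positions A f} with hY
  let key : LinExt α → (α → α → Prop) × Finset ι × Finset ℕ := fun f =>
    (fun a b => (a ∈ A ↔ b ∈ A) ∧ pos f a < pos f b, M f,
      positions A f \ ((M f).image p ∪ (M f).image q))
  have main := card_large_le_eight_mul_card_unbalanced key Y (fun k => k.2.1) ?_ ?_ ?_ s
  · refine main.trans (Nat.mul_le_mul_left 8 (card_le_card ?_))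
    intro f hf
    simp only [mem_filter, mem_univ, true_and] at hf ⊢
    change 2 * #(Y f) + 2 * s ≤ #(M f) at hf
    have e1 : #(univ.filter fun i => q i ∈ positions A f)
        = #(univ.filter fun i => q i ∈ positions A f ∧ p i ∈ positions A f) + #(Y f) := by
      rw [← card_filter_add_card_filter_not (s := univ.filter fun i => q i ∈ positions A f)
        (fun i => p i ∈ positions A f)]
      simp only [filter_filter, hY, and_comm]
    have e2 : #(univ.filter fun i => p i ∈ positions A f)
        = #(univ.filter fun i => q i ∈ positions A f ∧ p i ∈ positions A f)
          + #(univ.filter fun i => p i ∈ positions A f ∧ q i ∉ positions A f) := by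
      rw [← card_filter_add_card_filter_not (s := univ.filter fun i => p i ∈ positions A f)
        (fun i => q i ∈ positions A f)]
      simp only [filter_filter, and_comm]
    have e3 : #(M f) = #(Y f)
          + #(univ.filter fun i => p i ∈ positions A f ∧ q i ∉ positions A f) := by
      rw [← card_filter_add_card_filter_not (s := M f) (fun i => q i ∈ positions A f)]
      simp only [hM, hY, filter_filter]
      congr 2 <;> ext i <;> simp <;> tauto
    omega
  · intro f i hi
    simp only [hY, mem_filter, mem_univ, true_and] at hi
    simp only [key, hM, mem_filter, mem_univ, true_and]
    tauto
  · intro f g hk hYY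
    simp only [key, Prod.mk.injEq] at hk
    obtain ⟨h1, h2, h3⟩ := hk
    refine SameOrders.eq_of_positions_eq (A := A) ?_ ?_
    · intro a b hab
      have := congrFun (congrFun h1 a) b
      simpa [hab] using this
    · have recover : ∀ f : LinExt α, positions A f
          = (positions A f \ ((M f).image p ∪ (M f).image q)) ∪ (M f \ Y f).image p
            ∪ (Y f).image q := by
        intro f
        ext t
        simp only [mem_union, mem_sdiff, mem_image]
        constructor
        · intro ht
          by_cases hp' : ∃ i ∈ M f, p i = t
          · obtain ⟨i, hi, rfl⟩ := hp'
            left; right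
            refine ⟨i, ⟨hi, ?_⟩, rfl⟩
            simp [hY, ht]
          by_cases hq' : ∃ i ∈ M f, q i = t
          · obtain ⟨i, hi, rfl⟩ := hq'
            right
            refine ⟨i, ?_, rfl⟩
            simp only [hM, mem_filter, mem_univ, true_and] at hi
            simp only [hY, mem_filter, mem_univ, true_and]
            tauto
          left; left
          exact ⟨ht, not_or.2 ⟨hp', hq'⟩⟩
        · rintro ((h | ⟨i, ⟨hi, hi'⟩, rfl⟩) | ⟨i, hi, rfl⟩)
          · exact h.1
          · simp only [hM, hY, mem_filter, mem_univ, true_and] at hi hi'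
            tauto
          · simp only [hY, mem_filter, mem_univ, true_and] at hi
            exact hi.2
      rw [recover f, recover g, h3, h2, hYY]
  · intro f i hi
    simp only [hY, mem_filter, mem_univ, true_and] at hi
    obtain ⟨d, hd⟩ : ∃ d, q i = p i + d + 1 :=
      ⟨q i - p i - 1, by have := hpq i i; omega⟩
    obtain ⟨g, hg1, hg2⟩ := exists_advance hA d f (p i) hi.1 (hd ▸ hi.2)
    rw [← hd] at hg2
    have hpg : ∀ j, p j ∈ positions A g ↔ j = i ∨ p j ∈ positions A f := by
      intro j
      rw [hg2, mem_insert, mem_erase, hp.eq_iff]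
      have := (hpq j i).ne
      tauto
    have hqg : ∀ j, q j ∈ positions A g ↔ j ≠ i ∧ q j ∈ positions A f := by
      intro j
      rw [hg2, mem_insert, mem_erase, Ne, hq.eq_iff]
      have := (hpq i j).ne'
      tauto
    have hMg : M g = M f := by
      ext j
      simp only [hM, mem_filter, mem_univ, true_and, hpg, hqg]
      by_cases hji : j = i
      · subst hji; tauto
      · simp [hji]
    refine ⟨g, ?_, ?_⟩
    · simp only [key, Prod.mk.injEq]
      refine ⟨?_, hMg, ?_⟩
      · funext a b
        exact propext (and_congr_right fun hab => (hg1 a b hab).symm)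
      · rw [hMg]
        have hiM : i ∈ M f := by
          simp only [hM, mem_filter, mem_univ, true_and]
          tauto
        ext t
        simp only [mem_sdiff, hg2, mem_insert, mem_erase, mem_union]
        have h1 : p i ∈ (M f).image p := mem_image_of_mem _ hiM
        have h2 : q i ∈ (M f).image q := mem_image_of_mem _ hiM
        constructor
        · rintro ⟨rfl | h, h'⟩ <;> tauto
        · rintro ⟨h, h'⟩
          refine ⟨Or.inr ⟨?_, h⟩, h'⟩
          rintro rfl
          exact h' (Or.inr h2)
    · ext j
      simp only [hY, mem_filter, mem_univ, true_and, hpg, hqg, mem_erase]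
      tauto

end LinearExtensions

section Concentration
variable {α : Type*} [Fintype α] [PartialOrder α]

instance : Nonempty (LinExt α) := by
  let _ : Fintype (LinearExtension α) := inferInstanceAs (Fintype α)
  let e : Fin (Fintype.card α) ≃o LinearExtension α :=
    monoEquivOfFin (LinearExtension α) rfl
  refine ⟨⟨e.symm.toEquiv, fun x y hxy => ?_⟩⟩
  have h1 : (toLinearExtension x : LinearExtension α) ≤ toLinearExtension y :=
    toLinearExtension.monotone hxy.le
  exact e.symm.strictMono (lt_of_le_of_ne h1 hxy.ne)

/-- Every position `f(z)` has variance at most `L ^ 2`. -/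
def VarianceLE (α : Type*) [Fintype α] [PartialOrder α] (L : ℝ) : Prop :=
  ∀ z : α, ∑ f : LinExt α, ((val f z : ℝ) - expec z) ^ 2 ≤ L ^ 2 * Fintype.card (LinExt α)

lemma card_linExt_pos : (0 : ℝ) < Fintype.card (LinExt α) := by
  exact_mod_cast Fintype.card_pos

lemma sum_linExt_val (z : α) :
    ∑ f : LinExt α, (val f z : ℝ) = expec z * Fintype.card (LinExt α) := by
  have := card_linExt_pos (α := α)
  rw [expec, Nat.card_eq_fintype_card]
  field_simp

lemma expec_add_one_le {a b : α} (h : a < b) : expec a + 1 ≤ expec b := by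
  have hE := card_linExt_pos (α := α)
  have h1 : ∑ f : LinExt α, ((val f a : ℝ) + 1) ≤ ∑ f : LinExt α, (val f b : ℝ) := by
    refine sum_le_sum fun f _ => ?_
    have := pos_lt_pos f h
    rw [val_eq_pos_add_one, val_eq_pos_add_one]
    exact_mod_cast (by omega : pos f a + 1 + 1 ≤ pos f b + 1)
  rw [sum_add_distrib, sum_linExt_val, sum_linExt_val] at h1
  simp only [sum_const, card_univ, nsmul_eq_mul, mul_one] at h1
  nlinarith

lemma expec_le_card (a : α) : expec a ≤ Fintype.card α := by
  have hE := card_linExt_pos (α := α)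
  have h1 : ∑ f : LinExt α, (val f a : ℝ) ≤ ∑ f : LinExt α, (Fintype.card α : ℝ) := by
    refine sum_le_sum fun f _ => ?_
    have := pos_lt f a
    rw [val_eq_pos_add_one]
    exact_mod_cast this
  rw [sum_linExt_val] at h1
  simp only [sum_const, card_univ, nsmul_eq_mul] at h1
  nlinarith

lemma expec_nonneg (a : α) : 0 ≤ expec a := by
  rw [expec]; positivity

lemma VarianceLE.card_le_div {L : ℝ} (hV : VarianceLE α L) (z : α) {d : ℝ} (hd : 0 < d) :
    (#{f : LinExt α | d ≤ |(val f z : ℝ) - expec z|} : ℝ)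
      ≤ L ^ 2 / d ^ 2 * Fintype.card (LinExt α) := by
  rw [div_mul_eq_mul_div, le_div_iff₀ (by positivity)]
  refine le_trans ?_ (hV z)
  calc (#{f : LinExt α | d ≤ |(val f z : ℝ) - expec z|} : ℝ) * d ^ 2
      = ∑ f : LinExt α with d ≤ |(val f z : ℝ) - expec z|, d ^ 2 := by
        rw [sum_const, nsmul_eq_mul]
    _ ≤ ∑ f : LinExt α with d ≤ |(val f z : ℝ) - expec z|, ((val f z : ℝ) - expec z) ^ 2 := by
        refine sum_le_sum fun f hf => ?_
        rw [mem_filter] at hf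
        rw [← sq_abs ((val f z : ℝ) - expec z)]
        exact pow_le_pow_left₀ hd.le hf.2 2
    _ ≤ _ := sum_le_univ_sum_of_nonneg fun f => sq_nonneg _

lemma VarianceLE.card_le_quarter {L : ℝ} (hL : 1 ≤ L) (hV : VarianceLE α L) (z : α) :
    (#{f : LinExt α | 2 * L ≤ |(val f z : ℝ) - expec z|} : ℝ)
      ≤ Fintype.card (LinExt α) / 4 := by
  refine (hV.card_le_div z (d := 2 * L) (by linarith)).trans_eq ?_
  field_simp
  norm_num

lemma card_val_near_le (f : LinExt α) (u : ℝ) {r : ℝ} (hr : 0 ≤ r) :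
    (#{z : α | |(val f z : ℝ) - u| ≤ r} : ℝ) ≤ 2 * r + 1 := by
  have h1 : #{z : α | |(val f z : ℝ) - u| ≤ r} ≤ #(Icc ⌈u - r⌉ ⌊u + r⌋) := by
    refine card_le_card_of_injOn (fun z => (val f z : ℤ)) ?_ ?_
    · intro z hz
      simp only [coe_filter, mem_univ, true_and, Set.mem_ofPred_eq, abs_le] at hz
      simp only [coe_Icc, Set.mem_Icc, Int.ceil_le, Int.le_floor, Int.cast_natCast]
      constructor <;> linarith
    · intro x _ y _ hxy
      have hxy : (val f x : ℤ) = val f y := hxy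
      rw [val_eq_pos_add_one, val_eq_pos_add_one] at hxy
      exact pos_injective f (by omega)
  rw [Int.card_Icc] at h1
  have h2 : ((⌊u + r⌋ + 1 - ⌈u - r⌉).toNat : ℝ) ≤ 2 * r + 1 := by
    have h3 := Int.floor_le (u + r)
    have h4 := Int.le_ceil (u - r)
    have h5 : ((⌊u + r⌋ + 1 - ⌈u - r⌉).toNat : ℤ) = max (⌊u + r⌋ + 1 - ⌈u - r⌉) 0 :=
      Int.toNat_eq_max _
    have h6 : ((⌊u + r⌋ + 1 - ⌈u - r⌉).toNat : ℝ)
        = max ((⌊u + r⌋ : ℝ) + 1 - ⌈u - r⌉) 0 := by exact_mod_cast congrArg (Int.cast (R := ℝ)) h5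
    rw [h6]
    apply max_le <;> linarith
  exact le_trans (by exact_mod_cast h1) h2

/-- The mean positions cannot accumulate. -/
lemma VarianceLE.card_expec_near_le {L : ℝ} (hL : 1 ≤ L) (hV : VarianceLE α L) (u : ℝ) {r : ℝ}
    (hr : 0 ≤ r) :
    (#{z : α | |expec z - u| ≤ r} : ℝ) ≤ 4 / 3 * (2 * r + 4 * L + 1) := by
  classical
  have hE := card_linExt_pos (α := α)
  set Z : Finset α := {z : α | |expec z - u| ≤ r} with hZ
  have h1 : ∀ z ∈ Z, 3 / 4 * (Fintype.card (LinExt α) : ℝ)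
      ≤ #{f : LinExt α | |(val f z : ℝ) - u| ≤ r + 2 * L} := by
    intro z hz
    have hz : |expec z - u| ≤ r := by simpa [hZ] using hz
    have h2 := hV.card_le_quarter hL z
    have h3 : Fintype.card (LinExt α) ≤ #{f : LinExt α | |(val f z : ℝ) - u| ≤ r + 2 * L}
        + #{f : LinExt α | 2 * L ≤ |(val f z : ℝ) - expec z|} := by
      rw [← card_univ]
      refine (card_le_card ?_).trans (card_union_le _ _)
      intro f _
      simp only [mem_union, mem_filter, mem_univ, true_and]
      by_contra! h
      have := abs_sub_le (val f z : ℝ) (expec z) u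
      linarith
    have h4 : (Fintype.card (LinExt α) : ℝ) ≤ #{f : LinExt α | |(val f z : ℝ) - u| ≤ r + 2 * L}
        + #{f : LinExt α | 2 * L ≤ |(val f z : ℝ) - expec z|} := by exact_mod_cast h3
    linarith
  have h5 : ∑ z ∈ Z, #{f : LinExt α | |(val f z : ℝ) - u| ≤ r + 2 * L}
      = ∑ f : LinExt α, #{z ∈ Z | |(val f z : ℝ) - u| ≤ r + 2 * L} := by
    simp only [card_filter]
    exact sum_comm
  have h6 : ∑ f : LinExt α, (#{z ∈ Z | |(val f z : ℝ) - u| ≤ r + 2 * L} : ℝ)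
      ≤ ∑ f : LinExt α, (2 * r + 4 * L + 1) := by
    refine sum_le_sum fun f _ => ?_
    have h7 := card_val_near_le f u (r := r + 2 * L) (by linarith)
    have h8 : (#{z ∈ Z | |(val f z : ℝ) - u| ≤ r + 2 * L} : ℝ)
        ≤ #{z : α | |(val f z : ℝ) - u| ≤ r + 2 * L} := by
      exact_mod_cast card_le_card (filter_subset_filter _ (subset_univ _))
    linarith
  have h9 := sum_le_sum h1
  rw [sum_const, nsmul_eq_mul] at h9
  simp only [sum_const, card_univ, nsmul_eq_mul] at h6
  have h10 : (∑ z ∈ Z, #{f : LinExt α | |(val f z : ℝ) - u| ≤ r + 2 * L} : ℝ)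
      = ∑ f : LinExt α, (#{z ∈ Z | |(val f z : ℝ) - u| ≤ r + 2 * L} : ℝ) := by
    exact_mod_cast h5
  rw [h10] at h9
  have h11 : (Fintype.card (LinExt α) : ℝ) * (3 / 4 * #Z)
      ≤ Fintype.card (LinExt α) * (2 * r + 4 * L + 1) := by linarith
  have := le_of_mul_le_mul_left h11 hE
  linarith

lemma VarianceLE.sum_tail_le {L : ℝ} (hL : 1 ≤ L) (hV : VarianceLE α L) (t : ℝ) {d : ℝ}
    (hd : 1 ≤ d) :
    ∑ z : α with d ≤ |expec z - t|, L ^ 2 / (expec z - t) ^ 2 ≤ 64 * L ^ 3 / d := by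
  classical
  set F : Finset α := {z : α | d ≤ |expec z - t|} with hF
  set b : α → ℕ := fun z => ⌊|expec z - t|⌋₊ with hb
  set m := ⌊d⌋₊ with hm
  have hm1 : 1 ≤ m := Nat.le_floor (by simpa using hd)
  have hmd : d < m + 1 := Nat.lt_floor_add_one d
  have hm1' : (1 : ℝ) ≤ m := by exact_mod_cast hm1
  have hbm : ∀ z ∈ F, m ≤ b z := by
    intro z hz
    exact Nat.floor_mono (by simpa [hF] using hz)
  have hfib : ∀ k : ℕ, (#{z ∈ F | b z = k} : ℝ) ≤ 16 * L := by
    intro k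
    have h1 := hV.card_expec_near_le hL (t + (k + 1 / 2)) (r := 1 / 2) (by norm_num)
    have h2 := hV.card_expec_near_le hL (t - (k + 1 / 2)) (r := 1 / 2) (by norm_num)
    have h3 : #{z ∈ F | b z = k} ≤ #{z : α | |expec z - (t + (k + 1 / 2))| ≤ 1 / 2}
        + #{z : α | |expec z - (t - (k + 1 / 2))| ≤ 1 / 2} := by
      refine (card_le_card ?_).trans (card_union_le _ _)
      intro z hz
      simp only [mem_filter] at hz
      have h4 := Nat.floor_le (abs_nonneg (expec z - t))
      have h5 := Nat.lt_floor_add_one |expec z - t|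
      have h6 : ⌊|expec z - t|⌋₊ = k := hz.2
      rw [h6] at h4 h5
      simp only [mem_union, mem_filter, mem_univ, true_and]
      rcases abs_cases (expec z - t) with h | h
      · left; rw [abs_le]; constructor <;> linarith
      · right; rw [abs_le]; constructor <;> linarith
    have h3' : (#{z ∈ F | b z = k} : ℝ) ≤ #{z : α | |expec z - (t + (k + 1 / 2))| ≤ 1 / 2}
        + #{z : α | |expec z - (t - (k + 1 / 2))| ≤ 1 / 2} := by exact_mod_cast h3
    linarith
  have hsub : F.image b ⊆ Ioo (m - 1) ((F.image b).sup id + 1) := by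
    intro k hk
    rw [mem_Ioo]
    constructor
    · obtain ⟨z, hz, rfl⟩ := mem_image.1 hk
      have := hbm z hz
      omega
    · have : k ≤ (F.image b).sup id := le_sup (f := id) hk
      omega
  calc ∑ z ∈ F, L ^ 2 / (expec z - t) ^ 2
      ≤ ∑ z ∈ F, L ^ 2 * ((b z : ℝ) ^ 2)⁻¹ := by
        refine sum_le_sum fun z hz => ?_
        have h1 : (1 : ℝ) ≤ b z := by exact_mod_cast hm1.trans (hbm z hz)
        have h2 : (b z : ℝ) ≤ |expec z - t| := Nat.floor_le (abs_nonneg _)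
        rw [div_eq_mul_inv, ← sq_abs (expec z - t)]
        gcongr
    _ = ∑ k ∈ F.image b, ∑ z ∈ F with b z = k, L ^ 2 * ((b z : ℝ) ^ 2)⁻¹ :=
        (sum_fiberwise_of_maps_to (fun z hz => mem_image_of_mem b hz) _).symm
    _ = ∑ k ∈ F.image b, #{z ∈ F | b z = k} * (L ^ 2 * ((k : ℝ) ^ 2)⁻¹) := by
        refine sum_congr rfl fun k _ => ?_
        rw [← nsmul_eq_mul, ← sum_const]
        refine sum_congr rfl fun z hz => ?_
        rw [(mem_filter.1 hz).2]
    _ ≤ ∑ k ∈ F.image b, 16 * L * (L ^ 2 * ((k : ℝ) ^ 2)⁻¹) := by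
        refine sum_le_sum fun k _ => ?_
        gcongr
        exact hfib k
    _ = 16 * L ^ 3 * ∑ k ∈ F.image b, ((k : ℝ) ^ 2)⁻¹ := by
        rw [mul_sum]
        refine sum_congr rfl fun k _ => by ring
    _ ≤ 16 * L ^ 3 * ∑ k ∈ Ioo (m - 1) ((F.image b).sup id + 1), ((k : ℝ) ^ 2)⁻¹ := by
        gcongr
    _ ≤ 16 * L ^ 3 * (2 / m) := by
        gcongr
        have := sum_Ioo_inv_sq_le (α := ℝ) (m - 1) ((F.image b).sup id + 1)
        rw [Nat.cast_sub hm1] at this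
        simpa using this
    _ ≤ 16 * L ^ 3 * (4 / d) := by
        refine mul_le_mul_of_nonneg_left ?_ (by positivity)
        rw [div_le_div_iff₀ (by linarith) (by linarith)]
        linarith
    _ = 64 * L ^ 3 / d := by ring

/-- The number of elements of `A` among the first `t` positions. -/
def prefixCount (A : Finset α) (f : LinExt α) (t : ℕ) : ℕ := #{a ∈ A | val f a ≤ t}

/-- The number of elements of `A` whose mean position is at most `t`. -/
noncomputable def meanCount (A : Finset α) (t : ℕ) : ℕ := #{a ∈ A | expec a ≤ t}

lemma VarianceLE.sum_abs_prefixCount_sub_le {L : ℝ} (hL : 1 ≤ L) (hV : VarianceLE α L)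
    (A : Finset α) (t : ℕ) :
    ∑ f : LinExt α, |(prefixCount A f t : ℝ) - meanCount A t|
      ≤ 80 * L ^ 3 * Fintype.card (LinExt α) := by
  classical
  have hE := card_linExt_pos (α := α)
  have h1 : ∀ f : LinExt α, |(prefixCount A f t : ℝ) - meanCount A t|
      ≤ ∑ a : α, if (val f a ≤ t ↔ expec a ≤ t) then 0 else 1 := by
    intro f
    rw [prefixCount, meanCount, card_filter, card_filter, Nat.cast_sum, Nat.cast_sum,
      ← sum_sub_distrib]
    refine (abs_sum_le_sum_abs _ _).trans ?_
    refine le_trans (sum_le_sum fun a _ => ?_)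
      (sum_le_univ_sum_of_nonneg fun a => by split_ifs <;> norm_num)
    by_cases h2 : val f a ≤ t <;> by_cases h3 : expec a ≤ t <;> simp [h2, h3]
  have h4 : ∀ a : α, (#{f : LinExt α | ¬ (val f a ≤ t ↔ expec a ≤ t)} : ℝ)
      ≤ (if 1 ≤ |expec a - t| then L ^ 2 / (expec a - t) ^ 2 else 1)
        * Fintype.card (LinExt α) := by
    intro a
    split_ifs with h
    · rw [← sq_abs (expec a - t)]
      refine le_trans ?_ (hV.card_le_div a (d := |expec a - t|) (by linarith))
      norm_cast
      refine card_le_card fun f => ?_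
      simp only [mem_filter, mem_univ, true_and]
      intro h5
      by_cases h6 : val f a ≤ t
      · have h7 : ¬ expec a ≤ t := by tauto
        have h8 : (val f a : ℝ) ≤ t := by exact_mod_cast h6
        rw [abs_of_pos (by linarith), abs_of_neg (by linarith)]
        linarith
      · have h7 : expec a ≤ t := by tauto
        have h8 : (t : ℝ) < val f a := by exact_mod_cast not_le.1 h6
        rw [abs_of_nonpos (by linarith), abs_of_pos (by linarith)]
        linarith
    · rw [one_mul]
      exact_mod_cast card_le_univ _
  have h5 : ∑ a : α, (if 1 ≤ |expec a - t| then L ^ 2 / (expec a - t) ^ 2 else 1)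
      ≤ 80 * L ^ 3 := by
    rw [sum_ite]
    have h6 := hV.sum_tail_le hL t le_rfl
    have h7 : (∑ a : α with ¬ 1 ≤ |expec a - t|, (1 : ℝ)) ≤ 4 / 3 * (2 * 1 + 4 * L + 1) := by
      refine le_trans ?_ (hV.card_expec_near_le hL t (r := 1) (by norm_num))
      rw [sum_const, nsmul_eq_mul, mul_one]
      norm_cast
      refine card_le_card fun a => ?_
      simp only [mem_filter, mem_univ, true_and]
      intro h
      linarith
    have h8 : L ≤ L ^ 3 := le_self_pow₀ hL (by norm_num)
    linarith
  calc ∑ f : LinExt α, |(prefixCount A f t : ℝ) - meanCount A t|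
      ≤ ∑ f : LinExt α, ∑ a : α, if (val f a ≤ t ↔ expec a ≤ t) then (0 : ℝ) else 1 :=
        sum_le_sum fun f _ => h1 f
    _ = ∑ a : α, (#{f : LinExt α | ¬ (val f a ≤ t ↔ expec a ≤ t)} : ℝ) := by
        rw [sum_comm]
        refine sum_congr rfl fun a _ => ?_
        rw [card_filter, Nat.cast_sum]
        refine sum_congr rfl fun f _ => ?_
        by_cases h : (val f a ≤ t ↔ expec a ≤ t) <;> simp [h]
    _ ≤ ∑ a : α, (if 1 ≤ |expec a - t| then L ^ 2 / (expec a - t) ^ 2 else 1)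
        * Fintype.card (LinExt α) := sum_le_sum fun a _ => h4 a
    _ ≤ _ := by
        rw [← sum_mul]
        gcongr

lemma VarianceLE.card_prefixCount_deviation_le {L : ℝ} (hL : 1 ≤ L) (hV : VarianceLE α L)
    (A : Finset α) (t : ℕ) {S : ℝ} (hS : 0 < S) :
    (#{f : LinExt α | S ≤ |(prefixCount A f t : ℝ) - meanCount A t|} : ℝ)
      ≤ 80 * L ^ 3 / S * Fintype.card (LinExt α) := by
  rw [div_mul_eq_mul_div, le_div_iff₀ hS]
  refine le_trans ?_ (hV.sum_abs_prefixCount_sub_le hL A t)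
  calc (#{f : LinExt α | S ≤ |(prefixCount A f t : ℝ) - meanCount A t|} : ℝ) * S
      = ∑ f : LinExt α with S ≤ |(prefixCount A f t : ℝ) - meanCount A t|, S := by
        rw [sum_const, nsmul_eq_mul]
    _ ≤ ∑ f : LinExt α with S ≤ |(prefixCount A f t : ℝ) - meanCount A t|,
          |(prefixCount A f t : ℝ) - meanCount A t| :=
        sum_le_sum fun f hf => (mem_filter.1 hf).2
    _ ≤ _ := sum_le_univ_sum_of_nonneg fun f => abs_nonneg _

end Concentration

section Density
variable {α : Type*} [Fintype α] [PartialOrder α]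

open scoped Classical in
lemma card_le_card_lowered_one (a : α) (j₀ : ℕ) (Q : ℕ → Prop) (hQ : ∀ j, Q j → j₀ + 1 ≤ j) :
    #{f : LinExt α | (∀ z < a, pos f z < j₀) ∧ Q (pos f a)}
      ≤ #{f : LinExt α | (∀ z < a, pos f z < j₀) ∧ Q (pos f a + 1)} := by
  refine card_le_card_of_forall_subsingleton
    (fun f g => ∃ b, pos f a = pos f b + 1 ∧ pos g b = pos f a ∧ pos g a = pos f b ∧
      ∀ z, z ≠ b → z ≠ a → pos g z = pos f z) ?_ ?_
  · intro f hf
    simp only [mem_filter, mem_univ, true_and] at hf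
    have h1 := hQ _ hf.2
    have h2 := pos_lt f a
    obtain ⟨b, hb⟩ := exists_pos_eq f (t := pos f a - 1) (by omega)
    have hba : pos f a = pos f b + 1 := by omega
    have hnlt : ¬ b < a := fun h => by
      have := hf.1 b h
      omega
    obtain ⟨g, hg1, hg2, hg3⟩ := exists_adjacent_swap f hba hnlt
    refine ⟨g, ?_, b, hba, hg1, hg2, hg3⟩
    simp only [mem_filter, mem_univ, true_and]
    refine ⟨fun z hz => ?_, ?_⟩
    · rw [hg3 z (fun h => hnlt (h ▸ hz)) hz.ne]
      exact hf.1 z hz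
    · rw [hg2, ← hba]
      exact hf.2
  · rintro g - f₁ ⟨-, b₁, h1, h2, h3, h4⟩ f₂ ⟨-, b₂, k1, k2, k3, k4⟩
    obtain rfl : b₁ = b₂ := pos_injective g (by omega)
    refine linExt_ext fun z => ?_
    by_cases hb : z = b₁
    · subst hb; omega
    by_cases ha : z = a
    · subst ha; omega
    rw [← h4 z hb ha, ← k4 z hb ha]

open scoped Classical in
/-- If all predecessors of `a` lie early, then `a` can be moved down by `k` places. -/
lemma card_le_card_lowered (a : α) (j₀ : ℕ) (k : ℕ) : ∀ (Q : ℕ → Prop),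
    (∀ j, Q j → j₀ + k ≤ j) →
    #{f : LinExt α | (∀ z < a, pos f z < j₀) ∧ Q (pos f a)}
      ≤ #{f : LinExt α | (∀ z < a, pos f z < j₀) ∧ Q (pos f a + k)} := by
  induction k with
  | zero => exact fun Q _ => le_rfl
  | succ k ih =>
    intro Q hQ
    refine (ih Q fun j hj => by have := hQ j hj; omega).trans ?_
    refine (card_le_card_lowered_one a j₀ (fun j => Q (j + k))
      fun j hj => by have := hQ _ hj; omega).trans_eq ?_
    congr 1
    ext f
    simp only [add_assoc, add_comm 1 k]

lemma VarianceLE.exists_lt_expec_ge {L : ℝ} (hL : 1 ≤ L) (hV : VarianceLE α L) {g : ℝ}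
    (hg : 512 * L ^ 3 ≤ g) {a : α} (ha : g < expec a) : ∃ z < a, expec a - g ≤ expec z := by
  classical
  by_contra! hz
  have hE := card_linExt_pos (α := α)
  have hL3 : L ≤ L ^ 3 := le_self_pow₀ hL (by norm_num)
  set t : ℝ := expec a - g / 2 with ht
  set k : ℕ := ⌈4 * L⌉₊ with hk
  have hj₀ : (⌈t⌉₊ : ℝ) < t + 1 := Nat.ceil_lt_add_one (by linarith)
  have hj₀' : t ≤ ⌈t⌉₊ := Nat.le_ceil t
  have hk1 : (k : ℝ) < 4 * L + 1 := Nat.ceil_lt_add_one (by linarith)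
  have hk2 : 4 * L ≤ k := Nat.le_ceil _
  have hlate : (#{f : LinExt α | ∃ z < a, ⌈t⌉₊ ≤ pos f z} : ℝ)
      ≤ Fintype.card (LinExt α) / 4 := by
    have h1 : #{f : LinExt α | ∃ z < a, ⌈t⌉₊ ≤ pos f z}
        ≤ ∑ z : α with g / 2 ≤ |expec z - t|,
          #{f : LinExt α | |expec z - t| ≤ |(val f z : ℝ) - expec z|} := by
      refine (card_le_card ?_).trans card_biUnion_le
      intro f hf
      simp only [mem_filter, mem_univ, true_and] at hf
      obtain ⟨z, hza, hzt⟩ := hf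
      have h2 := hz z hza
      have h3 : t ≤ pos f z := hj₀'.trans (by exact_mod_cast hzt)
      simp only [mem_biUnion, mem_filter, mem_univ, true_and]
      refine ⟨z, ?_, ?_⟩
      · rw [abs_of_neg (by linarith)]
        linarith
      · rw [abs_of_neg (by linarith), val_eq_pos_add_one, Nat.cast_add_one,
          abs_of_pos (by linarith)]
        linarith
    have h4 : (∑ z : α with g / 2 ≤ |expec z - t|,
          #{f : LinExt α | |expec z - t| ≤ |(val f z : ℝ) - expec z|} : ℝ)
        ≤ ∑ z : α with g / 2 ≤ |expec z - t|,
          L ^ 2 / (expec z - t) ^ 2 * Fintype.card (LinExt α) := by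
      refine sum_le_sum fun z hz => ?_
      rw [mem_filter] at hz
      rw [← sq_abs (expec z - t)]
      exact hV.card_le_div z (by linarith)
    have h5 := hV.sum_tail_le hL t (d := g / 2) (by linarith)
    have h6 : 64 * L ^ 3 / (g / 2) ≤ 1 / 4 := by
      rw [div_le_iff₀ (by linarith)]
      linarith
    rw [← sum_mul] at h4
    have h1' : (#{f : LinExt α | ∃ z < a, ⌈t⌉₊ ≤ pos f z} : ℝ)
        ≤ ∑ z : α with g / 2 ≤ |expec z - t|,
          (#{f : LinExt α | |expec z - t| ≤ |(val f z : ℝ) - expec z|} : ℝ) := by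
      exact_mod_cast h1
    nlinarith
  have hfar := hV.card_le_quarter hL a
  have hcover : Fintype.card (LinExt α)
      ≤ #{f : LinExt α | (∀ z < a, pos f z < ⌈t⌉₊) ∧ |((pos f a : ℕ) : ℝ) + 1 - expec a| < 2 * L}
        + #{f : LinExt α | ∃ z < a, ⌈t⌉₊ ≤ pos f z}
        + #{f : LinExt α | 2 * L ≤ |(val f a : ℝ) - expec a|} := by
    rw [← card_univ]
    refine (card_le_card ?_).trans
      ((card_union_le _ _).trans (Nat.add_le_add_right (card_union_le _ _) _))
    intro f _
    simp only [mem_union, mem_filter, mem_univ, true_and, val_eq_pos_add_one, Nat.cast_add_one]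
    by_contra! h
    obtain ⟨⟨h1, h2⟩, h3⟩ := h
    linarith [h1 h2]
  have hlower := card_le_card_lowered a ⌈t⌉₊ k (fun j => |(j : ℝ) + 1 - expec a| < 2 * L) (by
    intro j hj
    rw [abs_lt] at hj
    have : ((⌈t⌉₊ + k : ℕ) : ℝ) ≤ j := by
      push_cast
      linarith
    exact_mod_cast this)
  have hmoved : #{f : LinExt α | (∀ z < a, pos f z < ⌈t⌉₊)
        ∧ |((pos f a + k : ℕ) : ℝ) + 1 - expec a| < 2 * L}
      ≤ #{f : LinExt α | 2 * L ≤ |(val f a : ℝ) - expec a|} := by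
    refine card_le_card fun f => ?_
    simp only [mem_filter, mem_univ, true_and, val_eq_pos_add_one, Nat.cast_add_one]
    rintro ⟨-, h⟩
    push_cast at h
    rw [abs_lt] at h
    rw [abs_of_neg (by linarith)]
    linarith
  have htotal : (Fintype.card (LinExt α) : ℝ)
      ≤ #{f : LinExt α | 2 * L ≤ |(val f a : ℝ) - expec a|}
        + #{f : LinExt α | ∃ z < a, ⌈t⌉₊ ≤ pos f z}
        + #{f : LinExt α | 2 * L ≤ |(val f a : ℝ) - expec a|} := by
    have h := hlower.trans hmoved
    exact_mod_cast hcover.trans (by gcongr)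
  linarith

/-- Reversing a linear extension. -/
def dualLinExt (α : Type*) [Fintype α] [PartialOrder α] : LinExt α ≃ LinExt αᵒᵈ where
  toFun f := ⟨OrderDual.ofDual.trans (f.1.trans Fin.revPerm), fun _ _ h =>
    Fin.rev_lt_rev.2 (f.2 _ _ (OrderDual.ofDual_lt_ofDual.2 h))⟩
  invFun f := ⟨OrderDual.toDual.trans (f.1.trans Fin.revPerm), fun _ _ h =>
    Fin.rev_lt_rev.2 (f.2 _ _ (OrderDual.toDual_lt_toDual.2 h))⟩
  left_inv _ := Subtype.ext (Equiv.ext fun _ => Fin.rev_rev _)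
  right_inv _ := Subtype.ext (Equiv.ext fun _ => Fin.rev_rev _)

lemma val_dualLinExt (f : LinExt α) (a : α) :
    (val (dualLinExt α f) (OrderDual.toDual a) : ℝ) = Fintype.card α + 1 - val f a := by
  have h : val (dualLinExt α f) (OrderDual.toDual a) + val f a = Fintype.card α + 1 := by
    have h1 : pos (dualLinExt α f) (OrderDual.toDual a)
        = Fintype.card α - (pos f a + 1) := Fin.val_rev _
    have h2 := pos_lt f a
    rw [val_eq_pos_add_one, val_eq_pos_add_one]
    omega
  have h' : (val (dualLinExt α f) (OrderDual.toDual a) : ℝ) + val f a = Fintype.card α + 1 := by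
    exact_mod_cast h
  linarith

lemma expec_toDual (a : α) : expec (OrderDual.toDual a) = Fintype.card α + 1 - expec a := by
  have hE := card_linExt_pos (α := α)
  have hc := Fintype.card_congr (dualLinExt α)
  have h1 := sum_linExt_val (OrderDual.toDual a)
  rw [← Equiv.sum_comp (dualLinExt α), ← hc] at h1
  simp only [val_dualLinExt, sum_sub_distrib, sum_const, card_univ, nsmul_eq_mul,
    sum_linExt_val] at h1
  have h2 : (Fintype.card (LinExt α) : ℝ) * (Fintype.card α + 1 - expec a)
      = Fintype.card (LinExt α) * expec (OrderDual.toDual a) := by linarith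
  exact (mul_left_cancel₀ hE.ne' h2).symm

lemma VarianceLE.dual {L : ℝ} (hV : VarianceLE α L) : VarianceLE αᵒᵈ L := by
  intro z
  have h := hV (OrderDual.ofDual z)
  rw [← Equiv.sum_comp (dualLinExt α), ← Fintype.card_congr (dualLinExt α)]
  refine le_of_eq_of_le (sum_congr rfl fun f _ => ?_) h
  have h1 := val_dualLinExt f (OrderDual.ofDual z)
  have h2 := expec_toDual (OrderDual.ofDual z)
  rw [OrderDual.toDual_ofDual] at h1 h2
  rw [h1, h2]
  ring

lemma VarianceLE.exists_gt_expec_le {L : ℝ} (hL : 1 ≤ L) (hV : VarianceLE α L) {g : ℝ}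
    (hg : 512 * L ^ 3 ≤ g) {a : α} (ha : expec a + g < Fintype.card α + 1) :
    ∃ z, a < z ∧ expec z ≤ expec a + g := by
  obtain ⟨z, hz, hz'⟩ := hV.dual.exists_lt_expec_ge hL hg (a := OrderDual.toDual a)
    (by rw [expec_toDual]; linarith)
  refine ⟨OrderDual.ofDual z, hz, ?_⟩
  have h1 := expec_toDual (OrderDual.ofDual z)
  rw [OrderDual.toDual_ofDual] at h1
  rw [h1, expec_toDual] at hz'
  linarith

lemma VarianceLE.exists_le_expec_mem_Ioc {L : ℝ} (hL : 1 ≤ L) (hV : VarianceLE α L) {g : ℝ}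
    (hg : 512 * L ^ 3 ≤ g) {y : α} {t : ℝ} (ht : 0 ≤ t) (hty : t < expec y) :
    ∃ a ≤ y, t < expec a ∧ expec a ≤ t + g := by
  classical
  obtain ⟨a, ha, hmin⟩ := exists_min_image {a : α | a ≤ y ∧ t < expec a} expec
    ⟨y, by simpa using hty⟩
  simp only [mem_filter, mem_univ, true_and] at ha hmin
  refine ⟨a, ha.1, ha.2, ?_⟩
  by_contra! h
  obtain ⟨z, hza, hz⟩ := hV.exists_lt_expec_ge hL hg (a := a) (by linarith)
  have h1 := hmin z ⟨hza.le.trans ha.1, by linarith⟩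
  have h2 := expec_add_one_le hza
  linarith

lemma VarianceLE.exists_ge_expec_mem_Ioc {L : ℝ} (hL : 1 ≤ L) (hV : VarianceLE α L) {g : ℝ}
    (hg : 512 * L ^ 3 ≤ g) {x : α} {t : ℝ} (htx : expec x ≤ t + g)
    (ht : t + g < Fintype.card α + 1) :
    ∃ b, x ≤ b ∧ t < expec b ∧ expec b ≤ t + g := by
  classical
  obtain ⟨b, hb, hmax⟩ := exists_max_image {b : α | x ≤ b ∧ expec b ≤ t + g} expec
    ⟨x, by simpa using htx⟩
  simp only [mem_filter, mem_univ, true_and] at hb hmax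
  refine ⟨b, hb.1, ?_, hb.2⟩
  by_contra! h
  obtain ⟨z, hbz, hz⟩ := hV.exists_gt_expec_le hL hg (a := b) (by linarith)
  have h1 := hmax z ⟨hb.1.trans hbz.le, by linarith⟩
  have h2 := expec_add_one_le hbz
  linarith

lemma meanCount_add_le {A : Finset α} {t G d : ℕ}
    (h : ∀ i < d, ∃ a ∈ A, (t + G * i : ℕ) < expec a ∧ expec a ≤ (t + G * (i + 1) : ℕ)) :
    meanCount A t + d ≤ meanCount A (t + G * d) := by
  classical
  induction d with
  | zero => simp
  | succ d ih =>
    have h1 := ih fun i hi => h i (by omega)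
    obtain ⟨a, ha, h2, h3⟩ := h d (by omega)
    have h4 : meanCount A (t + G * d) < meanCount A (t + G * (d + 1)) := by
      apply card_lt_card
      rw [ssubset_iff_of_subset]
      · exact ⟨a, by simp only [mem_filter]; exact ⟨ha, h3⟩, by simp only [mem_filter]; grind⟩
      · refine monotone_filter_right _ fun z _ hz => hz.trans ?_
        exact_mod_cast Nat.add_le_add_left (Nat.mul_le_mul_left G (Nat.le_succ d)) t
    omega

end Density

section Shifts

lemma card_filter_range_add (R : ℕ → Prop) [DecidablePred R] (t D : ℕ) :
    #{u ∈ range (t + D) | R u} = #{u ∈ range t | R u} + #{i : Fin D | R (t + i)} := by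
  rw [card_filter, card_filter, card_filter, sum_range_add,
    Finset.sum_range (fun i => if R (t + i) then 1 else 0)]

lemma card_mul_card_compl_le_sum_shifts {D : ℕ} [NeZero D] (u v : Finset (Fin D)) :
    #u * #vᶜ ≤ ∑ k : Fin D, #{i | ¬ (i ∈ u ↔ i + k ∈ v)} := by
  have h1 : ∀ i ∈ u, #{k : Fin D | ¬ (i ∈ u ↔ i + k ∈ v)} = #vᶜ := by
    intro i hi
    refine card_bij (fun k _ => i + k) ?_ (fun _ _ _ _ h => add_left_cancel h) ?_
    · intro k hk
      simpa [hi] using hk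
    · intro j hj
      exact ⟨j - i, by simpa [hi] using hj, by simp⟩
  calc #u * #vᶜ = ∑ i ∈ u, #{k : Fin D | ¬ (i ∈ u ↔ i + k ∈ v)} := by
        rw [sum_congr rfl h1, sum_const, smul_eq_mul]
    _ ≤ ∑ i : Fin D, #{k : Fin D | ¬ (i ∈ u ↔ i + k ∈ v)} :=
        sum_le_univ_sum_of_nonneg fun _ => Nat.zero_le _
    _ = _ := by
        simp only [card_filter]
        exact sum_comm

lemma le_mul_card_discordant_shifts {G d D m : ℕ} [NeZero D] (hD : D = G * d)
    (hm : 8 * G * m ≤ d) {u v : Finset (Fin D)} (huv : d ^ 2 ≤ 4 * (#u * #vᶜ)) :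
    d ≤ 8 * G * #{k : Fin D | m ≤ #{i | ¬ (i ∈ u ↔ i + k ∈ v)}} := by
  set X := #{k : Fin D | m ≤ #{i | ¬ (i ∈ u ↔ i + k ∈ v)}} with hX
  have h1 : ∑ k : Fin D, #{i | ¬ (i ∈ u ↔ i + k ∈ v)} ≤ D * X + D * m := by
    calc ∑ k : Fin D, #{i | ¬ (i ∈ u ↔ i + k ∈ v)}
        ≤ ∑ k : Fin D, ((if m ≤ #{i | ¬ (i ∈ u ↔ i + k ∈ v)} then D else 0) + m) := by
          refine sum_le_sum fun k _ => ?_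
          have : #{i | ¬ (i ∈ u ↔ i + k ∈ v)} ≤ D := (card_le_univ _).trans_eq (Fintype.card_fin D)
          split_ifs <;> omega
      _ = D * X + D * m := by
          rw [sum_add_distrib, ← sum_filter, sum_const, sum_const, card_univ, Fintype.card_fin,
            smul_eq_mul, smul_eq_mul, mul_comm D X]
  have h2 := card_mul_card_compl_le_sum_shifts u v
  have hd : 0 < d := by
    have := NeZero.pos D
    rw [hD] at this
    exact Nat.pos_of_mul_pos_left this
  have h3 : d * d ≤ d * (4 * G * (X + m)) := by
    calc d * d = d ^ 2 := (sq d).symm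
      _ ≤ 4 * (D * X + D * m) := huv.trans (by omega)
      _ = d * (4 * G * (X + m)) := by rw [hD]; ring
  have h4 := Nat.le_of_mul_le_mul_left h3 hd
  nlinarith

end Shifts

section Concavity
variable {α : Type*} [Fintype α] [PartialOrder α]

lemma prefixCount_eq_card_positions (A : Finset α) (f : LinExt α) (t : ℕ) :
    prefixCount A f t = #{u ∈ range t | u ∈ positions A f} := by
  rw [prefixCount]
  refine card_bij (fun a _ => pos f a) ?_ (fun _ _ _ _ h => pos_injective f h) ?_
  · intro a ha
    rw [mem_filter, val_eq_pos_add_one] at ha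
    simp only [mem_filter, mem_range, pos_mem_positions]
    exact ⟨by omega, ha.1⟩
  · intro u hu
    simp only [mem_filter, mem_range] at hu
    obtain ⟨a, ha, rfl⟩ := mem_image.1 hu.2
    exact ⟨a, by rw [mem_filter, val_eq_pos_add_one]; exact ⟨ha, by omega⟩, rfl⟩

lemma prefixCount_add (A : Finset α) (f : LinExt α) (t D : ℕ) :
    prefixCount A f (t + D) = prefixCount A f t + #{i : Fin D | t + i ∈ positions A f} := by
  simp only [prefixCount_eq_card_positions, card_filter_range_add (· ∈ positions A f)]

lemma prefixCount_add_prefixCount_compl [DecidableEq α] (A : Finset α) (f : LinExt α) {t : ℕ}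
    (ht : t ≤ Fintype.card α) : prefixCount A f t + prefixCount Aᶜ f t = t := by
  have h : ∀ u ∈ range t, (u ∈ positions Aᶜ f ↔ ¬ u ∈ positions A f) := by
    intro u hu
    obtain ⟨a, rfl⟩ := exists_pos_eq f ((mem_range.1 hu).trans_le ht)
    simp only [pos_mem_positions, mem_compl]
  rw [prefixCount_eq_card_positions, prefixCount_eq_card_positions, filter_congr h,
    card_filter_add_card_filter_not, card_range]

lemma card_le_mul_card_unbalanced {A : Finset α} (hA : IsLowerSet (A : Set α)) {G d t s : ℕ}
    (hG : 0 < G) (hd : 0 < d) (hm : 8 * G * (16 * s ^ 2 + 2) ≤ d)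
    (F : Finset (LinExt α))
    (hF : ∀ f ∈ F, d ^ 2 ≤ 4 * (#{i : Fin (G * d) | t + i ∈ positions A f}
      * #{i : Fin (G * d) | t + G * d + i ∉ positions A f})) :
    #F ≤ 64 * G ^ 2 * #{f : LinExt α |
      prefixCount A f t + prefixCount A f (t + G * d + G * d) + 2 * s
        ≤ 2 * prefixCount A f (t + G * d)} := by
  classical
  set D := G * d with hD
  have : NeZero D := ⟨(Nat.mul_pos hG hd).ne'⟩
  set u : LinExt α → Finset (Fin D) := fun f => {i | t + i ∈ positions A f} with hu
  set v : LinExt α → Finset (Fin D) := fun f => {i | t + D + i ∈ positions A f} with hv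
  set U : Finset (LinExt α) := {f | prefixCount A f t + prefixCount A f (t + D + D) + 2 * s
        ≤ 2 * prefixCount A f (t + D)} with hU
  have hpair : ∀ k : Fin D,
      #{f : LinExt α | 16 * s ^ 2 + 2 ≤ #{i | ¬ (i ∈ u f ↔ i + k ∈ v f)}} ≤ 8 * #U := by
    intro k
    have h := card_discordant_le_eight_mul hA (ι := Fin D) (p := fun i => t + i)
      (q := fun i => t + D + (i + k : Fin D))
      (fun i j hij => Fin.ext (Nat.add_left_cancel hij))
      (fun i j hij => add_right_cancel (Fin.ext (Nat.add_left_cancel hij)))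
      (fun i j => (Nat.add_lt_add_left i.2 t).trans_le (Nat.le_add_right _ _)) s
    simp only [hu, hv, mem_filter, mem_univ, true_and]
    refine h.trans (Nat.mul_le_mul_left 8 (card_le_card ?_))
    intro f hf
    simp only [mem_filter, mem_univ, true_and] at hf
    have h1 : #{i : Fin D | t + D + ((i + k : Fin D) : ℕ) ∈ positions A f}
        = #{i : Fin D | t + D + i ∈ positions A f} :=
      card_equiv (Equiv.addRight k) (by simp)
    have h2 := prefixCount_add A f t D
    have h3 := prefixCount_add A f (t + D) D
    simp only [hU, mem_filter, mem_univ, true_and]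
    omega
  have hmany : ∀ f ∈ F,
      d ≤ 8 * G * #{k : Fin D | 16 * s ^ 2 + 2 ≤ #{i | ¬ (i ∈ u f ↔ i + k ∈ v f)}} := by
    intro f hf
    refine le_mul_card_discordant_shifts hD hm ?_
    convert hF f hf using 4
    ext i
    simp [hv]
  have hswap : ∑ f ∈ F, #{k : Fin D | 16 * s ^ 2 + 2 ≤ #{i | ¬ (i ∈ u f ↔ i + k ∈ v f)}}
      ≤ D * (8 * #U) := by
    calc _ ≤ ∑ f : LinExt α,
          #{k : Fin D | 16 * s ^ 2 + 2 ≤ #{i | ¬ (i ∈ u f ↔ i + k ∈ v f)}} :=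
          sum_le_univ_sum_of_nonneg fun _ => Nat.zero_le _
      _ = ∑ k : Fin D,
          #{f : LinExt α | 16 * s ^ 2 + 2 ≤ #{i | ¬ (i ∈ u f ↔ i + k ∈ v f)}} := by
          exact sum_card_bipartiteAbove_eq_sum_card_bipartiteBelow
            (fun f k => 16 * s ^ 2 + 2 ≤ #{i | ¬ (i ∈ u f ↔ i + k ∈ v f)})
      _ ≤ ∑ _k : Fin D, 8 * #U := sum_le_sum fun k _ => hpair k
      _ = _ := by simp
  have htot : #F * d ≤ 8 * G * (D * (8 * #U)) := by
    calc #F * d = ∑ _f ∈ F, d := by simp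
      _ ≤ ∑ f ∈ F,
          8 * G * #{k : Fin D | 16 * s ^ 2 + 2 ≤ #{i | ¬ (i ∈ u f ↔ i + k ∈ v f)}} :=
          sum_le_sum hmany
      _ ≤ _ := by
          rw [← mul_sum]
          exact Nat.mul_le_mul_left _ hswap
  refine Nat.le_of_mul_le_mul_right (htot.trans_eq ?_) hd
  rw [hD]
  ring

lemma VarianceLE.meanCount_concave {L : ℝ} (hL : 1 ≤ L) (hV : VarianceLE α L) {A : Finset α}
    [DecidableEq α] (hA : IsLowerSet (A : Set α)) {G d S t : ℕ} (hG : 0 < G)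
    (hS : 80000 * L ^ 3 * G ^ 2 ≤ S) (hd : 8 * G * (16 * (2 * S + 1) ^ 2 + 2) ≤ d)
    (ht : t + G * d + G * d ≤ Fintype.card α)
    (hAd : meanCount A t + d ≤ meanCount A (t + G * d))
    (hBd : meanCount Aᶜ (t + G * d) + d ≤ meanCount Aᶜ (t + G * d + G * d)) :
    meanCount A t + meanCount A (t + G * d + G * d) + 2 ≤ 2 * meanCount A (t + G * d) := by
  set D := G * d with hD
  have hE := card_linExt_pos (α := α)
  have hL3 : 1 ≤ L ^ 3 := one_le_pow₀ hL
  have hG' : (1 : ℝ) ≤ G := by exact_mod_cast hG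
  have hS0 : (0 : ℝ) < S := lt_of_lt_of_le (by positivity) hS
  have hS4 : 4 * S ≤ d := by nlinarith
  have hd0 : 0 < d := lt_of_lt_of_le (by positivity) hd
  set bad : Finset α → ℕ → Finset (LinExt α) :=
    fun C r => {f | (S : ℝ) ≤ |(prefixCount C f r : ℝ) - meanCount C r|} with hbad
  have hbadcard : ∀ C r, 1000 * (G : ℝ) ^ 2 * #(bad C r) ≤ Fintype.card (LinExt α) := by
    intro C r
    have h1 := hV.card_prefixCount_deviation_le hL C r hS0
    have h2 : 80 * L ^ 3 / S * (1000 * (G : ℝ) ^ 2) ≤ 1 := by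
      rw [div_mul_eq_mul_div, div_le_one hS0]
      linarith
    calc 1000 * (G : ℝ) ^ 2 * #(bad C r)
        ≤ 1000 * (G : ℝ) ^ 2 * (80 * L ^ 3 / S * Fintype.card (LinExt α)) := by gcongr
      _ = 80 * L ^ 3 / S * (1000 * (G : ℝ) ^ 2) * Fintype.card (LinExt α) := by ring
      _ ≤ 1 * Fintype.card (LinExt α) := by gcongr
      _ = _ := one_mul _
  have hgood : ∀ C r f, f ∉ bad C r →
      prefixCount C f r < meanCount C r + S ∧ meanCount C r < prefixCount C f r + S := by
    intro C r f hf
    simp only [hbad, mem_filter, mem_univ, true_and, not_le, abs_lt] at hf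
    constructor
    · have : (prefixCount C f r : ℝ) < meanCount C r + S := by linarith
      exact_mod_cast this
    · have : (meanCount C r : ℝ) < prefixCount C f r + S := by linarith
      exact_mod_cast this
  classical
  set Bad : Finset (LinExt α) := bad A t ∪ bad A (t + D) ∪ bad A (t + D + D)
    ∪ bad Aᶜ (t + D) ∪ bad Aᶜ (t + D + D) with hBad
  have hBadcard : 200 * (G : ℝ) ^ 2 * #Bad ≤ Fintype.card (LinExt α) := by
    have h1 : #Bad ≤ #(bad A t) + #(bad A (t + D)) + #(bad A (t + D + D))
        + #(bad Aᶜ (t + D)) + #(bad Aᶜ (t + D + D)) := by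
      have i1 := card_union_le (bad A t) (bad A (t + D))
      have i2 := card_union_le (bad A t ∪ bad A (t + D)) (bad A (t + D + D))
      have i3 := card_union_le (bad A t ∪ bad A (t + D) ∪ bad A (t + D + D)) (bad Aᶜ (t + D))
      have i4 := card_union_le
        (bad A t ∪ bad A (t + D) ∪ bad A (t + D + D) ∪ bad Aᶜ (t + D)) (bad Aᶜ (t + D + D))
      rw [hBad]
      omega
    have h1' : (#Bad : ℝ) ≤ #(bad A t) + #(bad A (t + D)) + #(bad A (t + D + D))
        + #(bad Aᶜ (t + D)) + #(bad Aᶜ (t + D + D)) := by exact_mod_cast h1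
    have j := mul_le_mul_of_nonneg_left h1' (by positivity : 0 ≤ 1000 * (G : ℝ) ^ 2)
    have := hbadcard A t
    have := hbadcard A (t + D)
    have := hbadcard A (t + D + D)
    have := hbadcard Aᶜ (t + D)
    have := hbadcard Aᶜ (t + D + D)
    linarith
  have hspread := card_le_mul_card_unbalanced hA (t := t) hG hd0 hd Badᶜ (by
    intro f hf
    simp only [hBad, mem_compl, mem_union, not_or] at hf
    obtain ⟨⟨⟨⟨h1, h2⟩, -⟩, h4⟩, h5⟩ := hf
    have h1 := hgood _ _ _ h1
    have h2 := hgood _ _ _ h2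
    have h4 := hgood _ _ _ h4
    have h5 := hgood _ _ _ h5
    have e1 := prefixCount_add A f t D
    have e2 := prefixCount_add A f (t + D) D
    have e3 := prefixCount_add_prefixCount_compl A f (t := t + D) (by omega)
    have e4 := prefixCount_add_prefixCount_compl A f ht
    have e5 := card_filter_add_card_filter_not (s := univ (α := Fin D))
      (fun i => t + D + (i : ℕ) ∈ positions A f)
    rw [card_univ, Fintype.card_fin] at e5
    rw [← hD]
    have hl : d ≤ 2 * #{i : Fin D | t + i ∈ positions A f} := by omega
    have hr : d ≤ 2 * #{i : Fin D | t + D + i ∉ positions A f} := by omega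
    calc d ^ 2 = d * d := sq d
      _ ≤ _ := Nat.mul_le_mul hl hr
      _ = _ := by ring)
  obtain ⟨f, hfU, hfB⟩ : ∃ f : LinExt α, prefixCount A f t + prefixCount A f (t + D + D)
      + 2 * (2 * S + 1) ≤ 2 * prefixCount A f (t + D) ∧ f ∉ Bad := by
    by_contra! h
    have h1 : #{f : LinExt α | prefixCount A f t + prefixCount A f (t + D + D)
        + 2 * (2 * S + 1) ≤ 2 * prefixCount A f (t + D)} ≤ #Bad :=
      card_le_card fun f hf => h f (by simpa using hf)
    have h2 : Fintype.card (LinExt α) ≤ 64 * G ^ 2 * #Bad + #Bad := by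
      rw [← card_compl_add_card Bad]
      exact Nat.add_le_add_right (hspread.trans (Nat.mul_le_mul_left _ h1)) _
    have h3 : (Fintype.card (LinExt α) : ℝ) ≤ 64 * (G : ℝ) ^ 2 * #Bad + #Bad := by
      exact_mod_cast h2
    have h4 : (1 : ℝ) * #Bad ≤ (G : ℝ) ^ 2 * #Bad := by
      gcongr
      exact one_le_pow₀ hG'
    linarith
  simp only [hBad, mem_union, not_or] at hfB
  obtain ⟨⟨⟨⟨h1, h2⟩, h3⟩, -⟩, -⟩ := hfB
  have h1 := hgood _ _ _ h1
  have h2 := hgood _ _ _ h2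
  have h3 := hgood _ _ _ h3
  omega

end Concavity

section Gap
variable {α : Type*} [Fintype α] [PartialOrder α]

lemma VarianceLE.meanCount_add_le_of_le {L : ℝ} (hL : 1 ≤ L) (hV : VarianceLE α L)
    {A : Finset α} {y : α} (hA : ∀ z ≤ y, z ∈ A) {G d t : ℕ} (hG : 512 * L ^ 3 ≤ G)
    (ht : (t + G * d : ℕ) ≤ expec y) : meanCount A t + d ≤ meanCount A (t + G * d) := by
  have hG0 : (0 : ℝ) < G := lt_of_lt_of_le (by positivity) hG
  have hG0 : 0 < G := by exact_mod_cast hG0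
  refine meanCount_add_le fun i hi => ?_
  have h1 : ((t + G * i : ℕ) : ℝ) < (t + G * d : ℕ) := by
    exact_mod_cast Nat.add_lt_add_left (Nat.mul_lt_mul_of_pos_left hi hG0) t
  obtain ⟨a, ha, h2, h3⟩ := hV.exists_le_expec_mem_Ioc hL hG
    (t := (t + G * i : ℕ)) (Nat.cast_nonneg _) (h1.trans_le ht)
  refine ⟨a, hA a ha, h2, h3.trans_eq ?_⟩
  push_cast
  ring

lemma VarianceLE.meanCount_add_le_of_ge {L : ℝ} (hL : 1 ≤ L) (hV : VarianceLE α L)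
    {B : Finset α} {x : α} (hB : ∀ z, x ≤ z → z ∈ B) {G d t : ℕ} (hG : 512 * L ^ 3 ≤ G)
    (hxt : expec x ≤ t) (ht : t + G * d ≤ Fintype.card α) :
    meanCount B t + d ≤ meanCount B (t + G * d) := by
  refine meanCount_add_le fun i hi => ?_
  have h1 : t + G * i + G ≤ Fintype.card α := by
    have : G * (i + 1) ≤ G * d := Nat.mul_le_mul_left G hi
    linarith
  have h1' : ((t + G * i : ℕ) : ℝ) + G ≤ Fintype.card α := by exact_mod_cast h1
  have h2 : (t : ℝ) ≤ (t + G * i : ℕ) := by exact_mod_cast Nat.le_add_right _ _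
  have h3 : (0 : ℝ) ≤ G := Nat.cast_nonneg _
  obtain ⟨b, hb, h4, h5⟩ := hV.exists_ge_expec_mem_Ioc hL hG (x := x)
    (t := (t + G * i : ℕ)) (by linarith) (by linarith)
  refine ⟨b, hB b hb, h4, h5.trans_eq ?_⟩
  push_cast
  ring

lemma add_two_mul_le_of_concave {ν : ℕ → ℕ} {N : ℕ}
    (h : ∀ i, i + 2 ≤ N → ν i + ν (i + 2) + 2 ≤ 2 * ν (i + 1)) :
    ∀ i, i + 1 ≤ N → ν (i + 1) + ν 0 + 2 * i ≤ ν i + ν 1 := by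
  intro i
  induction i with
  | zero => intro _; simp [add_comm]
  | succ i ih =>
    intro hi
    have h1 := ih (by omega)
    have h2 := h i hi
    change ν (i + 2) + _ + _ ≤ _
    omega

lemma meanCount_mono (A : Finset α) : Monotone (meanCount A) := fun s t hst =>
  card_le_card (monotone_filter_right _ fun _ _ hz =>
    le_trans hz (by exact_mod_cast hst))

/-- An element whose mean position is far above that of `x` lies above `x`. -/
lemma exists_expec_gap_bound {L : ℝ} (hL : 1 ≤ L) :
    ∃ T : ℝ, 0 ≤ T ∧ ∀ (β : Type) [Fintype β] [PartialOrder β], VarianceLE β L →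
      ∀ x y : β, ¬ x ≤ y → expec y - expec x ≤ T := by
  obtain ⟨G, hG⟩ := exists_nat_ge (512 * L ^ 3)
  obtain ⟨S, hS⟩ := exists_nat_ge (80000 * L ^ 3 * (G : ℝ) ^ 2)
  obtain ⟨d, hd⟩ : ∃ d, d = 8 * G * (16 * (2 * S + 1) ^ 2 + 2) := ⟨_, rfl⟩
  obtain ⟨M, hM⟩ := exists_nat_ge (4 / 3 * ((G * d : ℕ) + 4 * L + 1))
  have hG0 : (0 : ℝ) < G := lt_of_lt_of_le (by positivity) hG
  have hG0 : 0 < G := by exact_mod_cast hG0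
  refine ⟨(G * d * (M + 2) : ℕ) + 1, by positivity, fun β _ _ hV x y hxy => ?_⟩
  classical
  by_contra! hgap
  set D := G * d with hD
  set t := ⌈expec x⌉₊ with ht
  have ht1 : expec x ≤ t := Nat.le_ceil _
  have ht2 : (t : ℝ) < expec x + 1 := Nat.ceil_lt_add_one (expec_nonneg x)
  set A : Finset β := {z | z ≤ y} with hA
  have hAlow : IsLowerSet (A : Set β) := fun a b hba ha => by
    simp only [hA, coe_filter, mem_univ, true_and, Set.mem_ofPred_eq] at ha ⊢
    exact hba.trans ha
  have hAy : ∀ z ≤ y, z ∈ A := fun z hz => by simpa [hA] using hz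
  have hAx : ∀ z, x ≤ z → z ∈ Aᶜ := fun z hz => by
    simp only [hA, mem_compl, mem_filter, mem_univ, true_and]
    exact fun h => hxy (hz.trans h)
  have hbound : ∀ i ≤ M + 2, ((t + D * i : ℕ) : ℝ) ≤ expec y := by
    intro i hi
    have h1 : ((D * i : ℕ) : ℝ) ≤ (D * (M + 2) : ℕ) := by
      exact_mod_cast Nat.mul_le_mul_left D hi
    rw [Nat.cast_add]
    linarith
  have hconc : ∀ i, i + 2 ≤ M + 2 → meanCount A (t + D * i) + meanCount A (t + D * (i + 2)) + 2
      ≤ 2 * meanCount A (t + D * (i + 1)) := by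
    intro i hi
    have e1 : t + D * (i + 1) = t + D * i + G * d := by rw [hD]; ring
    have e2 : t + D * (i + 2) = t + D * i + G * d + G * d := by rw [hD]; ring
    have b1 := hbound (i + 1) (by omega)
    have b2 := hbound (i + 2) hi
    rw [e1] at b1
    rw [e2] at b2
    have hn : t + D * i + G * d + G * d ≤ Fintype.card β := by
      exact_mod_cast b2.trans (expec_le_card y)
    rw [e1, e2]
    refine hV.meanCount_concave hL hAlow hG0 hS hd.ge hn
      (hV.meanCount_add_le_of_le hL hAy hG b1) (hV.meanCount_add_le_of_ge hL hAx hG ?_ hn)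
    refine ht1.trans ?_
    exact_mod_cast (by omega : t ≤ t + D * i + G * d)
  have hlast := add_two_mul_le_of_concave (ν := fun i => meanCount A (t + D * i)) hconc (M + 1)
    le_rfl
  have hmono : meanCount A (t + D * (M + 1)) ≤ meanCount A (t + D * (M + 1 + 1)) :=
    meanCount_mono A (Nat.add_le_add_left (Nat.mul_le_mul_left D (Nat.le_succ _)) t)
  have hfirst : meanCount A (t + D) ≤ meanCount A t + M := by
    have h1 := hV.card_expec_near_le hL (t + D / 2) (r := (D : ℝ) / 2) (by positivity)
    have h2 : #{z : β | |expec z - (t + D / 2)| ≤ (D : ℝ) / 2} ≤ M := by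
      have : (#{z : β | |expec z - (t + D / 2)| ≤ (D : ℝ) / 2} : ℝ) ≤ M := by linarith
      exact_mod_cast this
    refine le_trans ?_ (Nat.add_le_add_left h2 _)
    refine (card_le_card fun z hz => ?_).trans (card_union_le _ _)
    simp only [mem_filter, mem_union, mem_univ, true_and] at hz ⊢
    refine or_iff_not_imp_left.2 fun h => ?_
    have h3 : (t : ℝ) < expec z := not_le.1 fun h' => h ⟨hz.1, h'⟩
    have h4 := hz.2
    push_cast at h4
    rw [abs_le]
    constructor <;> linarith
  simp only [mul_zero, add_zero, mul_one] at hlast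
  omega

end Gap

/-- π ⇝ σ: for every real `L` there is `K` such that every finite poset
with `π(P) ≥ K` satisfies `σ(P) ≥ L`. -/
theorem stmt_0 :
    ∀ L : ℝ, ∃ K : ℝ,
      ∀ (β : Type) [Fintype β] [PartialOrder β],
        (∃ x : β, K ≤ (piVal x : ℝ)) → ∃ y : β, L ≤ sigma y := by
  intro L
  obtain ⟨T, hT, hgap⟩ := exists_expec_gap_bound (le_max_right L 1)
  refine ⟨4 / 3 * (2 * T + 4 * max L 1 + 1) + 1, fun β _ _ ⟨x, hx⟩ => ?_⟩
  by_contra! hσ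
  classical
  have hV : VarianceLE β (max L 1) := by
    intro z
    have h1 : sigma z < max L 1 := (hσ z).trans_le (le_max_left _ _)
    rw [sigma, Real.sqrt_lt' (by positivity), variance, Nat.card_eq_fintype_card,
      div_lt_iff₀ card_linExt_pos] at h1
    exact h1.le
  have h1 := hV.card_expec_near_le (le_max_right L 1) (expec x) hT
  have h2 : piVal x ≤ #{z : β | |expec z - expec x| ≤ T} := by
    rw [piVal, Nat.card_eq_fintype_card, Fintype.card_subtype]
    refine card_le_card fun y hy => ?_
    simp only [mem_filter, mem_univ, true_and] at hy ⊢
    rw [abs_le]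
    constructor
    · linarith [hgap β hV y x hy.2]
    · exact hgap β hV x y hy.1
  have h3 : (piVal x : ℝ) ≤ #{z : β | |expec z - expec x| ≤ T} := by exact_mod_cast h2
  linarith
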